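/- Privacy amplification for i.i.d. blocks (Lemma 3, general form): let (Y_𝒟, Z) = ((Y_d)_{d∈𝒟}, Z), 𝒟 = {1,…,D}, be random variables with a joint pmf on (∏_{d∈𝒟}𝒴_d) × 𝒵 with finite alphabets, and let (Y_𝒟^B, Z^B) denote B i.i.d. copies. For each d ∈ 𝒟 let ℱ_d be a two-universal family of functions 𝒴_d^B → {0,1}^{r_d}, and let F_d be uniformly distributed on ℱ_d, independently across d and independently of (Y_𝒟^B, Z^B). Then for every ε > 0: V( p_{F_𝒟(Y_𝒟^B) F_𝒟 Z^B}, p_{U} · p_{U_ℱ} · p_{Z^B} ) ≤ 2ε + sqrt( Σ_{∅ ≠ S ⊆ 𝒟} 2^{ r_S − B·H(Y_S | Z) + B·δ_S(B) } ), where F_𝒟(Y_𝒟^B) = (F_d(Y_d^B))_{d∈𝒟}, r_S = Σ_{d∈S} r_d, Y_S = (Y_d)_{d∈S}, 𝒴_S = ∏_{d∈S}𝒴_d, δ_S(B) ≜ log₂(|𝒴_S| + 3)·sqrt( (2/B)(D + log₂(1/ε)) ), H(Y_S|Z) is the single-copy base-2 conditional Shannon entropy, and p_U, p_{U_ℱ}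 are the uniform pmfs on ∏_{d∈𝒟}{0,1}^{r_d} and ∏_{d∈𝒟}ℱ_d. (In the paper this is applied with Y_d = Y_d^n, a length-n source block of sub-dealer d, and Z = (M_𝒟, X_U^n), the public communication together with the observations of an unauthorized set U.) -/

import Mathlib

open scoped BigOperators
open Finset Filter

noncomputable section

namespace SecretSharing

open scoped Classical

/-! ### Basic Shannon information quantities (base 2) on finite probability spaces -/

variable {Ω : Type*} [Fintype Ω]

/-- `p` is a probability mass function on the finite type `Ω`. -/
def IsPMF (p : Ω → ℝ) : Prop := (∀ ω, 0 ≤ p ω) ∧ ∑ ω : Ω, p ω = 1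

/-- Probability that the random variable `X` takes the value `a` under `p`. -/
def prob (p : Ω → ℝ) {A : Type*} (X : Ω → A) (a : A) : ℝ :=
  ∑ ω : Ω, if X ω = a then p ω else 0

/-- Shannon entropy (in bits) of the random variable `X` under `p`. -/
def ent (p : Ω → ℝ) {A : Type*} [Fintype A] (X : Ω → A) : ℝ :=
  -∑ a : A, prob p X a * Real.logb 2 (prob p X a)

/-- Conditional Shannon entropy `H(X | Y)` in bits. -/
def condEnt (p : Ω → ℝ) {A B : Type*} [Fintype A] [Fintype B]
    (X : Ω → A) (Y : Ω → B) : ℝ :=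
  ent p (fun ω => (X ω, Y ω)) - ent p Y

/-- Mutual information `I(X ; Y)` in bits. -/
def mutInf (p : Ω → ℝ) {A B : Type*} [Fintype A] [Fintype B]
    (X : Ω → A) (Y : Ω → B) : ℝ :=
  ent p X + ent p Y - ent p (fun ω => (X ω, Y ω))

/-- Conditional mutual information `I(X ; Y | Z)` in bits. -/
def condMutInf (p : Ω → ℝ) {A B C : Type*} [Fintype A] [Fintype B] [Fintype C]
    (X : Ω → A) (Y : Ω → B) (Z : Ω → C) : ℝ :=
  condEnt p X Z - condEnt p X (fun ω => (Y ω, Z ω))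


/-- Conditional min-entropy `H∞(w | q) = −log₂ max_{a, z ∈ supp(q)} w(a,z)/q(z)`
of a (sub-normalized nonnegative) joint function `w` given a pmf `q`. -/
def condMinEnt {A Z : Type*} (w : A → Z → ℝ) (q : Z → ℝ) : ℝ :=
  - Real.logb 2 (sSup {y : ℝ | ∃ a z, q z ≠ 0 ∧ y = w a z / q z})

/-- Min-entropy `H∞(w) = −log₂ max w`. -/
def minEnt {A : Type*} (w : A → ℝ) : ℝ :=
  - Real.logb 2 (sSup (Set.range w))

/-- A family `F` of hash functions (given by the evaluation map `ev`) from `A`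
to `{0,1}^r` is two-universal: for `x ≠ x'`, a uniformly chosen member collides
on `x, x'` with probability at most `2^{-r}`. -/
def TwoUniversal {A : Type*} (F : Type*) [Fintype F] {r : ℕ}
    (ev : F → A → (Fin r → Bool)) : Prop :=
  ∀ x x' : A, x ≠ x' →
    ((Finset.univ.filter (fun f : F => ev f x = ev f x')).card : ℝ)
        / (Fintype.card F : ℝ)
      ≤ ((2 : ℝ) ^ r)⁻¹


lemma coll_bound {D : ℕ} {Y F : Fin D → Type} [∀ d, Fintype (Y d)]
    [∀ d, Fintype (F d)] [∀ d, Nonempty (F d)]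
    (r : Fin D → ℕ) (ev : ∀ d, F d → Y d → (Fin (r d) → Bool))
    (huniv : ∀ d, TwoUniversal (F d) (ev d)) (y y' : ∀ d, Y d) :
    (∑ f : ∀ d, F d, if ∀ d, ev d (f d) (y d) = ev d (f d) (y' d) then (1 : ℝ) else 0)
      ≤ (∏ d, (Fintype.card (F d) : ℝ)) * ((∏ d, (2 : ℝ) ^ r d)⁻¹ *
        ∑ S : Finset (Fin D), if ∀ d ∈ S, y d = y' d then ∏ d ∈ S, (2 : ℝ) ^ r d else 0) := by
  have h1 : (∑ f : ∀ d, F d, if ∀ d, ev d (f d) (y d) = ev d (f d) (y' d) then (1 : ℝ) else 0)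
      = ∏ d, ∑ f : F d, if ev d f (y d) = ev d f (y' d) then (1 : ℝ) else 0 := by
    rw [Finset.prod_univ_sum]
    simp only [Fintype.piFinset_univ]
    refine Finset.sum_congr rfl fun f _ => ?_
    rw [Finset.prod_ite_zero]
    simp
  have h2 : ∀ d, (∑ f : F d, if ev d f (y d) = ev d f (y' d) then (1 : ℝ) else 0)
      ≤ (Fintype.card (F d) : ℝ) * (((2 : ℝ) ^ r d)⁻¹ * if y d = y' d then (2 : ℝ) ^ r d else 1) := by
    intro d
    have hc : (0 : ℝ) < Fintype.card (F d) := by exact_mod_cast Fintype.card_pos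
    by_cases h : y d = y' d
    · simp [h]
    · have := huniv d _ _ h
      rw [div_le_iff₀ hc] at this
      simp only [h, if_false, mul_one]
      rw [mul_comm]
      simpa [Finset.sum_boole] using this
  rw [h1]
  refine (Finset.prod_le_prod (fun d _ => Finset.sum_nonneg fun f _ => by split_ifs <;> norm_num)
    (fun d _ => h2 d)).trans ?_
  rw [Finset.prod_mul_distrib, Finset.prod_mul_distrib, Finset.prod_inv_distrib]
  have h3 : (∏ d, if y d = y' d then (2 : ℝ) ^ r d else 1)
      ≤ ∑ S : Finset (Fin D), if ∀ d ∈ S, y d = y' d then ∏ d ∈ S, (2 : ℝ) ^ r d else 0 := by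
    rw [← Finset.prod_filter]
    refine le_trans (le_of_eq ?_) (Finset.single_le_sum
      (f := fun S : Finset (Fin D) => if ∀ d ∈ S, y d = y' d then ∏ d ∈ S, (2 : ℝ) ^ r d else 0)
      (fun S _ => by split_ifs <;> positivity) (Finset.mem_univ (univ.filter fun d => y d = y' d)))
    simp
  gcongr

lemma lhl_z {D : ℕ} {Y F : Fin D → Type} [∀ d, Fintype (Y d)]
    [∀ d, Fintype (F d)] [∀ d, Nonempty (F d)]
    (r : Fin D → ℕ) (ev : ∀ d, F d → Y d → (Fin (r d) → Bool))
    (huniv : ∀ d, TwoUniversal (F d) (ev d))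
    (w : (∀ d, Y d) → ℝ) (q : ℝ) (c : Finset (Fin D) → ℝ) (hc : ∀ S, 0 ≤ c S)
    (hw : ∀ y, 0 ≤ w y) (hwq : ∑ y, w y ≤ q)
    (hS : ∀ S : Finset (Fin D), S.Nonempty → ∀ y : ∀ d, Y d,
      (∑ y' : ∀ d, Y d, if ∀ d ∈ S, y d = y' d then w y' else 0) ≤ q * c S) :
    ∑ k : ∀ d, Fin (r d) → Bool, ∑ f : ∀ d, F d,
      |(∑ y, if ∀ d, ev d (f d) (y d) = k d then w y else 0)
        - (∏ d, (2 : ℝ) ^ r d)⁻¹ * ∑ y, w y|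
    ≤ (∏ d, (Fintype.card (F d) : ℝ)) * (q * Real.sqrt (∑ S : Finset (Fin D),
        if S.Nonempty then (∏ d ∈ S, (2 : ℝ) ^ r d) * c S else 0)) := by
  set Kc : ℝ := ∏ d, (2 : ℝ) ^ r d with hKc
  set Fc : ℝ := ∏ d, (Fintype.card (F d) : ℝ) with hFc
  set W := ∑ y, w y with hW
  set C := ∑ S : Finset (Fin D),
        if S.Nonempty then (∏ d ∈ S, (2 : ℝ) ^ r d) * c S else 0 with hC
  have hKpos : 0 < Kc := by positivity
  have hFpos : 0 < Fc := Finset.prod_pos fun d _ => by exact_mod_cast Fintype.card_pos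
  have hW0 : 0 ≤ W := Finset.sum_nonneg fun y _ => hw y
  have hq0 : 0 ≤ q := hW0.trans hwq
  have hC0 : 0 ≤ C := Finset.sum_nonneg fun S _ => by
    split_ifs
    · exact mul_nonneg (by positivity) (hc S)
    · exact le_rfl
  set G : (∀ d, Fin (r d) → Bool) → (∀ d, F d) → ℝ :=
    fun k f => ∑ y, if ∀ d, ev d (f d) (y d) = k d then w y else 0 with hG
  have hcardK : (Fintype.card (∀ d, Fin (r d) → Bool) : ℝ) = Kc := by
    simp [Fintype.card_pi, hKc]
  have hcardF : (Fintype.card (∀ d, F d) : ℝ) = Fc := by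
    simp [Fintype.card_pi, hFc]
  have e1 : ∀ f, ∑ k, G k f = W := by
    intro f
    simp only [hG]
    rw [Finset.sum_comm]
    refine Finset.sum_congr rfl fun y _ => ?_
    rw [Finset.sum_eq_single (fun d => ev d (f d) (y d))]
    · simp
    · intro k _ hk
      rw [if_neg]
      intro h
      exact hk (funext fun d => (h d).symm)
    · simp
  have e2 : ∀ f, ∑ k, G k f ^ 2 = ∑ y, ∑ y', w y * w y' *
      (if ∀ d, ev d (f d) (y d) = ev d (f d) (y' d) then (1 : ℝ) else 0) := by
    intro f
    have : ∀ k, G k f ^ 2 = ∑ y, ∑ y', (if ∀ d, ev d (f d) (y d) = k d then w y else 0) *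
        (if ∀ d, ev d (f d) (y' d) = k d then w y' else 0) := by
      intro k
      rw [sq, Finset.sum_mul_sum]
    simp only [this]
    rw [Finset.sum_comm]
    refine Finset.sum_congr rfl fun y _ => ?_
    rw [Finset.sum_comm]
    refine Finset.sum_congr rfl fun y' _ => ?_
    rw [Finset.sum_eq_single (fun d => ev d (f d) (y d))]
    · simp [eq_comm]
    · intro k _ hk
      rw [if_neg, zero_mul]
      intro h
      exact hk (funext fun d => (h d).symm)
    · simp
  have e3 : ∑ f, ∑ k, G k f ^ 2 ≤ Fc * (Kc⁻¹ * (W ^ 2 + W * q * C)) := by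
    have s1 : ∑ f, ∑ k, G k f ^ 2 = ∑ y, ∑ y', w y * w y' * ∑ f : ∀ d, F d,
        (if ∀ d, ev d (f d) (y d) = ev d (f d) (y' d) then (1 : ℝ) else 0) := by
      simp only [e2]
      rw [Finset.sum_comm]
      refine Finset.sum_congr rfl fun y _ => ?_
      rw [Finset.sum_comm]
      refine Finset.sum_congr rfl fun y' _ => ?_
      rw [Finset.mul_sum]
    rw [s1]
    calc _ ≤ ∑ y, ∑ y', w y * w y' * (Fc * (Kc⁻¹ *
        ∑ S : Finset (Fin D), if ∀ d ∈ S, y d = y' d then ∏ d ∈ S, (2 : ℝ) ^ r d else 0)) := by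
          refine Finset.sum_le_sum fun y _ => Finset.sum_le_sum fun y' _ => ?_
          exact mul_le_mul_of_nonneg_left (coll_bound r ev huniv y y') (mul_nonneg (hw y) (hw y'))
      _ = Fc * (Kc⁻¹ * ∑ S : Finset (Fin D), (∏ d ∈ S, (2 : ℝ) ^ r d) *
            ∑ y, w y * ∑ y', if ∀ d ∈ S, y d = y' d then w y' else 0) := by
          simp only [Finset.mul_sum]
          rw [Finset.sum_comm' (t' := univ) (s' := fun _ => univ) (by simp)]
          conv_lhs => enter [2, x]; rw [Finset.sum_comm]
          rw [Finset.sum_comm]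
          refine Finset.sum_congr rfl fun S _ => ?_
          rw [Finset.sum_comm]
          refine Finset.sum_congr rfl fun y _ => Finset.sum_congr rfl fun y' _ => ?_
          split_ifs <;> ring
      _ ≤ _ := by
          gcongr
          calc _ ≤ ∑ S : Finset (Fin D), ((if S = ∅ then W ^ 2 else 0) + W * q *
                (if S.Nonempty then (∏ d ∈ S, (2 : ℝ) ^ r d) * c S else 0)) := by
                refine Finset.sum_le_sum fun S _ => ?_
                rcases S.eq_empty_or_nonempty with rfl | hne
                · simp [← Finset.sum_mul, ← hW, sq]
                · rw [if_neg hne.ne_empty, if_pos hne, zero_add]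
                  calc _ ≤ (∏ d ∈ S, (2 : ℝ) ^ r d) * ∑ y, w y * (q * c S) := by
                        gcongr with y
                        · exact hw y
                        · exact hS S hne y
                    _ = _ := by rw [← Finset.sum_mul]; ring
            _ = _ := by
                rw [Finset.sum_add_distrib, ← Finset.mul_sum]
                simp [hC]
  have e4 : ∑ f, ∑ k, (G k f - Kc⁻¹ * W) ^ 2 ≤ Fc * (Kc⁻¹ * (q ^ 2 * C)) := by
    have : ∀ f, ∑ k, (G k f - Kc⁻¹ * W) ^ 2 = ∑ k, G k f ^ 2 - Kc⁻¹ * W ^ 2 := by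
      intro f
      have : ∀ k, (G k f - Kc⁻¹ * W) ^ 2 = G k f ^ 2 - (2 * Kc⁻¹ * W) * G k f + (Kc⁻¹ * W) ^ 2 := by
        intro k; ring
      simp only [this, Finset.sum_add_distrib, Finset.sum_sub_distrib, ← Finset.mul_sum, e1]
      rw [Finset.sum_const, Finset.card_univ, nsmul_eq_mul, hcardK]
      field_simp
      ring
    simp only [this, Finset.sum_sub_distrib]
    rw [Finset.sum_const, Finset.card_univ, nsmul_eq_mul, hcardF]
    have : Fc * (Kc⁻¹ * (W * q * C)) ≤ Fc * (Kc⁻¹ * (q ^ 2 * C)) := by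
      gcongr
      nlinarith
    linarith [e3, mul_add Fc (Kc⁻¹ * W ^ 2) (Kc⁻¹ * (W * q * C)), mul_add Kc⁻¹ (W^2) (W * q * C)]
  rw [← Fintype.sum_prod_type']
  refine abs_le_of_sq_le_sq' ?_ (by positivity) |>.2
  refine (sq_sum_le_card_mul_sum_sq).trans ?_
  rw [Finset.card_univ, Fintype.card_prod, Nat.cast_mul, hcardK, hcardF]
  simp only [sq_abs]
  rw [Fintype.sum_prod_type, Finset.sum_comm]
  calc _ ≤ Kc * Fc * (Fc * (Kc⁻¹ * (q ^ 2 * C))) := by gcongr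
    _ = (Fc * (q * Real.sqrt C)) ^ 2 := by
      rw [mul_pow, mul_pow, Real.sq_sqrt hC0]
      field_simp

lemma smooth_z {D : ℕ} {Y F : Fin D → Type} [∀ d, Fintype (Y d)]
    [∀ d, Fintype (F d)] [∀ d, Nonempty (F d)]
    (r : Fin D → ℕ) (ev : ∀ d, F d → Y d → (Fin (r d) → Bool))
    (huniv : ∀ d, TwoUniversal (F d) (ev d))
    (P w : (∀ d, Y d) → ℝ) (c : Finset (Fin D) → ℝ) (hc : ∀ S, 0 ≤ c S)
    (hw : ∀ y, 0 ≤ w y) (hwP : ∀ y, w y ≤ P y)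
    (hS : ∀ S : Finset (Fin D), S.Nonempty → ∀ y : ∀ d, Y d,
      (∑ y' : ∀ d, Y d, if ∀ d ∈ S, y d = y' d then w y' else 0) ≤ (∑ y, P y) * c S) :
    ∑ k : ∀ d, Fin (r d) → Bool, ∑ f : ∀ d, F d,
      |(∏ d, (Fintype.card (F d) : ℝ))⁻¹ *
          (∑ y, if ∀ d, ev d (f d) (y d) = k d then P y else 0)
        - (Fintype.card (∀ d, Fin (r d) → Bool) : ℝ)⁻¹ *
            (Fintype.card (∀ d, F d) : ℝ)⁻¹ * ∑ y, P y|
    ≤ 2 * ∑ y, (P y - w y) + (∑ y, P y) * Real.sqrt (∑ S : Finset (Fin D),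
        if S.Nonempty then (∏ d ∈ S, (2 : ℝ) ^ r d) * c S else 0) := by
  have key := lhl_z r ev huniv w (∑ y, P y) c hc hw (Finset.sum_le_sum fun y _ => hwP y) hS
  set C := Real.sqrt (∑ S : Finset (Fin D),
        if S.Nonempty then (∏ d ∈ S, (2 : ℝ) ^ r d) * c S else 0) with hC
  have hcardK : (Fintype.card (∀ d, Fin (r d) → Bool) : ℝ) = ∏ d, (2 : ℝ) ^ r d := by
    simp [Fintype.card_pi]
  have hcardF : (Fintype.card (∀ d, F d) : ℝ) = ∏ d, (Fintype.card (F d) : ℝ) := by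
    simp [Fintype.card_pi]
  have hFpos : 0 < ∏ d, (Fintype.card (F d) : ℝ) :=
    Finset.prod_pos fun d _ => by exact_mod_cast Fintype.card_pos
  have hKpos : 0 < ∏ d, (2 : ℝ) ^ r d := by positivity
  rw [hcardK, hcardF]
  set Kc : ℝ := ∏ d, (2 : ℝ) ^ r d with hKc
  set Fc : ℝ := ∏ d, (Fintype.card (F d) : ℝ) with hFc
  have hterm : ∀ (k : ∀ d, Fin (r d) → Bool) (f : ∀ d, F d),
      |Fc⁻¹ * (∑ y, if ∀ d, ev d (f d) (y d) = k d then P y else 0) - Kc⁻¹ * Fc⁻¹ * ∑ y, P y|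
      ≤ Fc⁻¹ * |(∑ y, if ∀ d, ev d (f d) (y d) = k d then w y else 0) - Kc⁻¹ * ∑ y, w y|
        + Fc⁻¹ * ((∑ y, if ∀ d, ev d (f d) (y d) = k d then P y - w y else 0)
          + Kc⁻¹ * ∑ y, (P y - w y)) := by
    intro k f
    have h1 : (∑ y, if ∀ d, ev d (f d) (y d) = k d then P y else 0) =
        (∑ y, if ∀ d, ev d (f d) (y d) = k d then w y else 0) +
        (∑ y, if ∀ d, ev d (f d) (y d) = k d then P y - w y else 0) := by
      rw [← Finset.sum_add_distrib]
      refine Finset.sum_congr rfl fun y _ => ?_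
      split_ifs <;> ring
    have h2 : ∑ y, P y = ∑ y, w y + ∑ y, (P y - w y) := by
      rw [← Finset.sum_add_distrib]
      refine Finset.sum_congr rfl fun y _ => ?_
      ring
    have h3 : 0 ≤ (∑ y, if ∀ d, ev d (f d) (y d) = k d then P y - w y else 0) :=
      Finset.sum_nonneg fun y _ => by
        split_ifs
        · linarith [hwP y]
        · exact le_rfl
    have h4 : 0 ≤ Kc⁻¹ * ∑ y, (P y - w y) :=
      mul_nonneg (by positivity) (Finset.sum_nonneg fun y _ => by linarith [hwP y])
    rw [h1, h2, ← mul_add]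
    set a := (∑ y, if ∀ d, ev d (f d) (y d) = k d then w y else 0)
    set b := (∑ y, if ∀ d, ev d (f d) (y d) = k d then P y - w y else 0)
    set e := ∑ y, (P y - w y)
    have : Fc⁻¹ * (a + b) - Kc⁻¹ * Fc⁻¹ * (∑ y, w y + e)
      = Fc⁻¹ * ((a - Kc⁻¹ * ∑ y, w y) + (b - Kc⁻¹ * e)) := by ring
    rw [this, abs_mul, abs_of_pos (inv_pos.2 hFpos)]
    gcongr
    refine (abs_add_le _ _).trans ?_
    gcongr
    rw [abs_le]
    constructor <;> linarith
  refine (Finset.sum_le_sum fun k _ => Finset.sum_le_sum fun f _ => hterm k f).trans ?_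
  have e1 : ∀ f : ∀ d, F d, ∑ k : ∀ d, Fin (r d) → Bool,
      (∑ y, if ∀ d, ev d (f d) (y d) = k d then P y - w y else 0) = ∑ y, (P y - w y) := by
    intro f
    rw [Finset.sum_comm]
    refine Finset.sum_congr rfl fun y _ => ?_
    rw [Finset.sum_eq_single (fun d => ev d (f d) (y d))]
    · simp
    · intro k _ hk
      rw [if_neg]
      intro h
      exact hk (funext fun d => (h d).symm)
    · simp
  simp only [Finset.sum_add_distrib, ← Finset.mul_sum]
  have e2 : ∑ k : ∀ d, Fin (r d) → Bool, ∑ f : ∀ d, F d,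
      (∑ y, if ∀ d, ev d (f d) (y d) = k d then P y - w y else 0) = Fc * ∑ y, (P y - w y) := by
    rw [Finset.sum_comm]
    simp only [e1]
    rw [Finset.sum_const, Finset.card_univ, nsmul_eq_mul, hcardF]
  rw [e2]
  simp only [Finset.sum_const, Finset.card_univ, nsmul_eq_mul, hcardF, hcardK]
  set X := ∑ k : ∀ d, Fin (r d) → Bool, ∑ f : ∀ d, F d,
      |(∑ y, if ∀ d, ev d (f d) (y d) = k d then w y else 0)
        - Kc⁻¹ * ∑ y, w y|
  have : Fc⁻¹ * X ≤ (∑ y, P y) * C := by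
    rw [inv_mul_le_iff₀ hFpos]
    exact key
  have h5 : Fc⁻¹ * (Fc * ∑ y, (P y - w y) + Kc * (Fc * (Kc⁻¹ * ∑ y, (P y - w y))))
      = 2 * ∑ y, (P y - w y) := by
    field_simp
    ring
  linarith

lemma concave_logsq : ConcaveOn ℝ (Set.Ici (Real.exp 1)) (fun x => Real.log x ^ 2) := by
  have hd : ∀ x : ℝ, 0 < x → HasDerivAt (fun x => Real.log x ^ 2) (2 * (Real.log x / x)) x := by
    intro x hx
    have := (Real.hasDerivAt_log hx.ne').pow 2
    refine this.congr_deriv ?_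
    simp
    ring
  refine AntitoneOn.concaveOn_of_deriv (convex_Ici _) ?_ ?_ ?_
  · intro x hx
    exact (hd x ((Real.exp_pos 1).trans_le hx)).continuousAt.continuousWithinAt
  · rw [interior_Ici]
    intro x hx
    exact (hd x ((Real.exp_pos 1).trans hx)).differentiableAt.differentiableWithinAt
  · rw [interior_Ici]
    intro x hx y hy hxy
    rw [(hd x ((Real.exp_pos 1).trans hx)).deriv, (hd y ((Real.exp_pos 1).trans hy)).deriv]
    have := Real.log_div_self_antitoneOn (Set.mem_ofPred.2 (le_of_lt hx)) (Set.mem_ofPred.2 (le_of_lt hy)) hxy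
    simp only at this
    linarith

lemma exp_neg_le_quad (x : ℝ) (hx : 0 ≤ x) : Real.exp (-x) ≤ 1 - x + x ^ 2 / 2 := by
  have h := Real.quadratic_le_exp_of_nonneg hx
  have hp : 0 < 1 + x + x ^ 2 / 2 := by positivity
  rw [Real.exp_neg]
  refine (inv_anti₀ hp h).trans ?_
  rw [inv_le_iff_one_le_mul₀ hp]
  nlinarith [sq_nonneg (x ^ 2)]

/-- weights `P a z`, marginal `Q z`; second-moment bound. -/
lemma second_moment {A C : Type*} [Fintype A] [Fintype C] (P : A × C → ℝ) (Q : C → ℝ)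
    (hP : ∀ x, 0 ≤ P x) (hP1 : ∑ x, P x = 1) (hQ : ∀ z, ∑ a, P (a, z) = Q z) :
    ∑ x : A × C, P x * Real.log (P x / Q x.2) ^ 2 ≤ Real.log ((Fintype.card A : ℝ) + 3) ^ 2 := by
  have he : Real.exp 1 ≤ 3 := by linarith [Real.exp_one_lt_d9]
  have hQ0 : ∀ z, 0 ≤ Q z := fun z => hQ z ▸ Finset.sum_nonneg fun a _ => hP _
  have hPQ : ∀ x, P x ≤ Q x.2 := fun x => by
    rw [← hQ x.2]
    exact Finset.single_le_sum (f := fun a => P (a, x.2)) (fun a _ => hP _) (Finset.mem_univ x.1)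
  have hu : ∀ x : A × C, 3 ≤ Q x.2 / P x + 3 := fun x => by
    have := div_nonneg (hQ0 x.2) (hP x); linarith
  have hJ := concave_logsq.le_map_sum (t := univ) (w := P) (p := fun x : A × C => Q x.2 / P x + 3)
    (fun x _ => hP x) hP1 (fun x _ => he.trans (hu x))
  simp only [smul_eq_mul] at hJ
  have hm : ∑ x : A × C, P x * (Q x.2 / P x + 3) ≤ (Fintype.card A : ℝ) + 3 := by
    simp only [mul_add, Finset.sum_add_distrib, ← Finset.sum_mul, hP1]
    have : ∑ x : A × C, P x * (Q x.2 / P x) ≤ ∑ x : A × C, Q x.2 := by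
      refine Finset.sum_le_sum fun x _ => ?_
      rcases eq_or_ne (P x) 0 with h | h
      · simp [h, hQ0]
      · rw [mul_div_cancel₀ _ h]
    have h2 : ∑ x : A × C, Q x.2 = Fintype.card A := by
      rw [Fintype.sum_prod_type]
      simp only [Finset.sum_const, Finset.card_univ, nsmul_eq_mul]
      have : ∑ z, Q z = 1 := by
        rw [← hP1, Fintype.sum_prod_type, Finset.sum_comm]
        simp [hQ]
      rw [this, mul_one]
    linarith
  have hm3 : 3 ≤ ∑ x : A × C, P x * (Q x.2 / P x + 3) := by
    calc (3 : ℝ) = ∑ x : A × C, P x * 3 := by rw [← Finset.sum_mul, hP1, one_mul]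
      _ ≤ _ := Finset.sum_le_sum fun x _ => mul_le_mul_of_nonneg_left (hu x) (hP x)
  calc _ ≤ ∑ x : A × C, P x * Real.log (Q x.2 / P x + 3) ^ 2 := by
        refine Finset.sum_le_sum fun x _ => ?_
        rcases eq_or_ne (P x) 0 with h | h
        · simp [h]
        · have hpos : 0 < P x := lt_of_le_of_ne (hP x) h.symm
          have h1 : 1 ≤ Q x.2 / P x := (one_le_div hpos).2 (hPQ x)
          gcongr ?_ * ?_
          rw [← inv_div, Real.log_inv, neg_sq]
          have := Real.log_nonneg h1
          gcongr
          linarith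
    _ ≤ _ := hJ
    _ ≤ _ := by
        have : 0 ≤ Real.log (∑ x : A × C, P x * (Q x.2 / P x + 3)) :=
          Real.log_nonneg (by linarith)
        gcongr

lemma prob_nonneg {Ω A : Type*} [Fintype Ω] (p : Ω → ℝ) (hp : IsPMF p) (X : Ω → A) (a : A) :
    0 ≤ prob p X a :=
  Finset.sum_nonneg fun ω _ => by
    split_ifs
    · exact hp.1 ω
    · exact le_rfl

lemma le_prob {Ω A : Type*} [Fintype Ω] (p : Ω → ℝ) (hp : IsPMF p) (X : Ω → A) (ω : Ω) :
    p ω ≤ prob p X (X ω) := by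
  have := Finset.single_le_sum (f := fun ω' => if X ω' = X ω then p ω' else 0)
    (fun ω' _ => by
      split_ifs
      · exact hp.1 _
      · exact le_rfl) (Finset.mem_univ ω)
  simpa [prob] using this

lemma sum_prob_mul {Ω A : Type*} [Fintype Ω] [Fintype A] (p : Ω → ℝ) (X : Ω → A) (g : A → ℝ) :
    ∑ a, prob p X a * g a = ∑ ω, p ω * g (X ω) := by
  simp only [prob, Finset.sum_mul]
  rw [Finset.sum_comm]
  refine Finset.sum_congr rfl fun ω _ => ?_
  simp [ite_mul]

lemma prob_marg {Ω A C : Type*} [Fintype Ω] [Fintype A] (p : Ω → ℝ) (X : Ω → A)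
    (Z : Ω → C) (z : C) : ∑ a, prob p (fun ω => (X ω, Z ω)) (a, z) = prob p Z z := by
  simp only [prob]
  rw [Finset.sum_comm]
  refine Finset.sum_congr rfl fun ω _ => ?_
  by_cases h : Z ω = z <;> simp [h]

lemma condEnt_eq {Ω A C : Type*} [Fintype Ω] [Fintype A] [Fintype C] (p : Ω → ℝ) (hp : IsPMF p)
    (X : Ω → A) (Z : Ω → C) :
    Real.log 2 * condEnt p X Z = - ∑ x : A × C, prob p (fun ω => (X ω, Z ω)) x *
      Real.log (prob p (fun ω => (X ω, Z ω)) x / prob p Z x.2) := by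
  have h2 : Real.log 2 ≠ 0 := (Real.log_pos (by norm_num)).ne'
  unfold condEnt ent
  rw [sum_prob_mul p (fun ω => (X ω, Z ω)), sum_prob_mul p Z, sum_prob_mul p (fun ω => (X ω, Z ω))
    (fun x => Real.log (prob p (fun ω => (X ω, Z ω)) x / prob p Z x.2))]
  rw [neg_sub_neg, mul_sub, Finset.mul_sum, Finset.mul_sum, ← Finset.sum_sub_distrib,
    ← Finset.sum_neg_distrib]
  refine Finset.sum_congr rfl fun ω _ => ?_
  rcases eq_or_lt_of_le (hp.1 ω) with h | h
  · simp [← h]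
  · have a1 := h.trans_le (le_prob p hp Z ω)
    have a2 := h.trans_le (le_prob p hp (fun ω => (X ω, Z ω)) ω)
    rw [Real.log_div a2.ne' a1.ne', Real.logb, Real.logb]
    field_simp
    ring

lemma mgf_bound {A C : Type*} [Fintype A] [Fintype C] (P : A × C → ℝ) (Q : C → ℝ)
    (hP : ∀ x, 0 ≤ P x) (hP1 : ∑ x, P x = 1) (hQ : ∀ z, ∑ a, P (a, z) = Q z) (t : ℝ) (ht : 0 ≤ t) :
    ∑ x : A × C, P x * Real.exp (t * Real.log (P x / Q x.2))
      ≤ Real.exp (t * ∑ x : A × C, P x * Real.log (P x / Q x.2)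
        + t ^ 2 * Real.log ((Fintype.card A : ℝ) + 3) ^ 2 / 2) := by
  have hQ0 : ∀ z, 0 ≤ Q z := fun z => hQ z ▸ Finset.sum_nonneg fun a _ => hP _
  have hPQ : ∀ x, P x ≤ Q x.2 := fun x => by
    rw [← hQ x.2]
    exact Finset.single_le_sum (f := fun a => P (a, x.2)) (fun a _ => hP _) (Finset.mem_univ x.1)
  calc _ ≤ ∑ x : A × C, P x * (1 + t * Real.log (P x / Q x.2)
        + t ^ 2 * Real.log (P x / Q x.2) ^ 2 / 2) := by
        refine Finset.sum_le_sum fun x _ => mul_le_mul_of_nonneg_left ?_ (hP x)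
        have hl : Real.log (P x / Q x.2) ≤ 0 :=
          Real.log_nonpos (div_nonneg (hP x) (hQ0 _)) (div_le_one_of_le₀ (hPQ x) (hQ0 _))
        have := exp_neg_le_quad (-(t * Real.log (P x / Q x.2))) (by nlinarith)
        rw [neg_neg] at this
        refine this.trans (le_of_eq ?_)
        ring
    _ = 1 + t * ∑ x : A × C, P x * Real.log (P x / Q x.2)
        + t ^ 2 / 2 * ∑ x : A × C, P x * Real.log (P x / Q x.2) ^ 2 := by
        conv_rhs => rw [← hP1]
        rw [Finset.mul_sum, Finset.mul_sum, ← Finset.sum_add_distrib, ← Finset.sum_add_distrib]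
        refine Finset.sum_congr rfl fun x _ => ?_
        ring
    _ ≤ 1 + (t * ∑ x : A × C, P x * Real.log (P x / Q x.2)
        + t ^ 2 * Real.log ((Fintype.card A : ℝ) + 3) ^ 2 / 2) := by
        have := mul_le_mul_of_nonneg_left (second_moment P Q hP hP1 hQ) (by positivity : 0 ≤ t ^ 2 / 2)
        linarith
    _ ≤ _ := by
        rw [add_comm 1]
        exact Real.add_one_le_exp _

lemma tail {Ω A C : Type*} [Fintype Ω] [Fintype A] [Fintype C] (p : Ω → ℝ) (hp : IsPMF p)
    (X : Ω → A) (Z : Ω → C) (B : ℕ) (T : ℝ) (hT : 0 ≤ T) :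
    (∑ ω : Fin B → Ω, if (2 : ℝ) ^ (-((B : ℝ) * condEnt p X Z) + (B : ℝ) *
        (Real.logb 2 ((Fintype.card A : ℝ) + 3) * Real.sqrt ((2 / (B : ℝ)) * T)))
          * ∏ i, prob p Z (Z (ω i)) < ∏ i, prob p (fun ω => (X ω, Z ω)) (X (ω i), Z (ω i))
      then ∏ i, p (ω i) else 0) ≤ (2 : ℝ) ^ (-T) := by
  rcases Nat.eq_zero_or_pos B with rfl | hB
  · simp
    positivity
  have hB' : (0 : ℝ) < B := by exact_mod_cast hB
  set H := condEnt p X Z with hH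
  set u := Real.sqrt ((2 / (B : ℝ)) * T) with hu
  have hu2 : u ^ 2 = (2 / (B : ℝ)) * T := Real.sq_sqrt (by positivity)
  have hu0 : 0 ≤ u := Real.sqrt_nonneg _
  set Λ := Real.log ((Fintype.card A : ℝ) + 3) with hΛ
  have hΛ0 : 0 < Λ := Real.log_pos (by
    have : (0 : ℝ) ≤ Fintype.card A := by positivity
    linarith)
  have hl2 : 0 < Real.log 2 := Real.log_pos (by norm_num)
  set PP := prob p (fun ω => (X ω, Z ω)) with hPP
  set Q := prob p Z with hQ
  set t := u / Λ with ht
  have ht0 : 0 ≤ t := by positivity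
  set s := Real.log 2 * ((B : ℝ) * H) - B * (Λ * u) with hs
  have hpt : ∀ ω : Fin B → Ω, (if (2 : ℝ) ^ (-((B : ℝ) * H) + (B : ℝ) *
        (Real.logb 2 ((Fintype.card A : ℝ) + 3) * u))
          * ∏ i, Q (Z (ω i)) < ∏ i, PP (X (ω i), Z (ω i))
      then ∏ i, p (ω i) else 0) ≤ Real.exp (t * s) *
        ∏ i, (p (ω i) * Real.exp (t * Real.log (PP (X (ω i), Z (ω i)) / Q (Z (ω i))))) := by
    intro ω
    have hnn : 0 ≤ Real.exp (t * s) *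
        ∏ i, (p (ω i) * Real.exp (t * Real.log (PP (X (ω i), Z (ω i)) / Q (Z (ω i))))) :=
      mul_nonneg (Real.exp_pos _).le (Finset.prod_nonneg fun i _ =>
        mul_nonneg (hp.1 _) (Real.exp_pos _).le)
    split_ifs with hbad
    · by_cases hz : ∃ i, p (ω i) = 0
      · obtain ⟨i, hi⟩ := hz
        rw [Finset.prod_eq_zero (Finset.mem_univ i) hi]
        exact hnn
      · push Not at hz
        have hpos : ∀ i, 0 < p (ω i) := fun i => lt_of_le_of_ne (hp.1 _) (hz i).symm
        have a1 : ∀ i, 0 < Q (Z (ω i)) := fun i => (hpos i).trans_le (le_prob p hp Z _)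
        have a2 : ∀ i, 0 < PP (X (ω i), Z (ω i)) :=
          fun i => (hpos i).trans_le (le_prob p hp (fun ω => (X ω, Z ω)) _)
        have hlog := Real.log_lt_log (mul_pos (by positivity) (Finset.prod_pos fun i _ => a1 i)) hbad
        rw [Real.log_mul (by positivity) (Finset.prod_pos fun i _ => a1 i).ne',
          Real.log_prod (fun i _ => (a1 i).ne'), Real.log_prod (fun i _ => (a2 i).ne'),
          Real.log_rpow (by norm_num)] at hlog
        have hsum : ∑ i, t * Real.log (PP (X (ω i), Z (ω i)) / Q (Z (ω i))) =
            t * (∑ i, Real.log (PP (X (ω i), Z (ω i))) - ∑ i, Real.log (Q (Z (ω i)))) := by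
          rw [← Finset.mul_sum, ← Finset.sum_sub_distrib]
          congr 1
          refine Finset.sum_congr rfl fun i _ => ?_
          rw [Real.log_div (a2 i).ne' (a1 i).ne']
        rw [Finset.prod_mul_distrib, ← Real.exp_sum, hsum, mul_left_comm, ← Real.exp_add]
        refine le_mul_of_one_le_right (Finset.prod_nonneg fun i _ => hp.1 _) ?_
        rw [Real.one_le_exp_iff, ← mul_add]
        refine mul_nonneg ht0 ?_
        have : (-((B : ℝ) * H) + (B : ℝ) *
          (Real.logb 2 ((Fintype.card A : ℝ) + 3) * u)) * Real.log 2 = -s := by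
          rw [hs, Real.logb, ← hΛ]
          field_simp
          ring
        linarith
    · exact hnn
  refine (Finset.sum_le_sum fun ω _ => hpt ω).trans ?_
  rw [← Finset.mul_sum]
  have hpow : ∑ ω : Fin B → Ω,
        ∏ i, (p (ω i) * Real.exp (t * Real.log (PP (X (ω i), Z (ω i)) / Q (Z (ω i)))))
      = (∑ x : A × C, PP x * Real.exp (t * Real.log (PP x / Q x.2))) ^ B := by
    rw [sum_prob_mul p (fun ω => (X ω, Z ω)) (fun x => Real.exp (t * Real.log (PP x / Q x.2)))]
    rw [Finset.sum_pow', Fintype.piFinset_univ]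
  have hP1 : ∑ x, PP x = 1 := by
    have := sum_prob_mul p (fun ω => (X ω, Z ω)) (fun _ => 1)
    simpa [hp.2] using this
  have hm := mgf_bound PP Q (prob_nonneg p hp _) hP1 (prob_marg p X Z) t ht0
  rw [hpow]
  calc _ ≤ Real.exp (t * s) * (Real.exp (t * ∑ x : A × C, PP x * Real.log (PP x / Q x.2)
        + t ^ 2 * Λ ^ 2 / 2)) ^ B := by
        gcongr
        exact Finset.sum_nonneg fun x _ => mul_nonneg (prob_nonneg p hp _ _) (Real.exp_pos _).le
    _ = Real.exp (-T) := by
        have hc := condEnt_eq p hp X Z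
        rw [← Real.exp_nat_mul, ← Real.exp_add]
        congr 1
        have : ∑ x : A × C, PP x * Real.log (PP x / Q x.2) = - (Real.log 2 * H) := by
          rw [hH, hc, neg_neg]
        rw [this, hs, ht]
        have hT' : T = B * u ^ 2 / 2 := by rw [hu2]; field_simp
        rw [hT']
        field_simp
        ring
    _ ≤ _ := by
        rw [Real.rpow_def_of_pos (by norm_num)]
        refine Real.exp_le_exp.2 ?_
        have : Real.log 2 ≤ 1 := by linarith [Real.log_two_lt_d9]
        nlinarith

lemma sum_block {D B : ℕ} {𝒴 : Fin D → Type} [∀ d, Fintype (𝒴 d)]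
    (g : Fin B → (∀ d, 𝒴 d) → ℝ) :
    ∑ y : ∀ d, Fin B → 𝒴 d, ∏ i, g i (fun d => y d i) = ∏ i, ∑ yy : ∀ d, 𝒴 d, g i yy := by
  rw [Finset.prod_univ_sum, Fintype.piFinset_univ]
  exact Fintype.sum_equiv (Equiv.piComm (fun (d : Fin D) (_ : Fin B) => 𝒴 d)) _ _ (fun y => rfl)

lemma sum_omega {D B : ℕ} {𝒴 : Fin D → Type} [∀ d, Fintype (𝒴 d)] {𝒵 : Type} [Fintype 𝒵]
    (g : (Fin B → (∀ d, 𝒴 d) × 𝒵) → ℝ) :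
    ∑ zB : Fin B → 𝒵, ∑ y : ∀ d, Fin B → 𝒴 d, g (fun i => (fun d => y d i, zB i))
      = ∑ ω, g ω := by
  rw [← Fintype.sum_prod_type']
  refine Fintype.sum_equiv
    { toFun := fun x i => (fun d => x.2 d i, x.1 i)
      invFun := fun ω => (fun i => (ω i).2, fun d i => (ω i).1 d)
      left_inv := fun x => rfl
      right_inv := fun x => rfl } _ _ (fun y => rfl)

lemma sum_rot {K F Z : Type*} [Fintype K] [Fintype F] [Fintype Z] (g : K → F → Z → ℝ) :
    ∑ k, ∑ f, ∑ z, g k f z = ∑ z, ∑ k, ∑ f, g k f z := by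
  have : ∀ k, ∑ f, ∑ z, g k f z = ∑ z, ∑ f, g k f z := fun k => Finset.sum_comm
  simp only [this]
  exact Finset.sum_comm

set_option maxHeartbeats 1000000 in
/-- **Lemma 3 (Privacy amplification for i.i.d. blocks, general form).** For a
pmf `p` on `(∏ d, 𝒴 d) × 𝒵`, `B` i.i.d. copies, independent uniformly chosen
members `F_d` of two-universal families hashing `𝒴_d^B` into `{0,1}^{r_d}`, and
any `ε > 0`, the variational distance between `p_{F_𝒟(Y_𝒟^B) F_𝒟 Z^B}` and
`p_U · p_{U_ℱ} · p_{Z^B}` is at most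
`2ε + √(Σ_{∅ ≠ S ⊆ 𝒟} 2^{r_S − B H(Y_S|Z) + B δ_S(B)})`. -/
theorem privacy_amplification
    {D : ℕ} {𝒴 : Fin D → Type} [∀ d, Fintype (𝒴 d)] [∀ d, Nonempty (𝒴 d)]
    {𝒵 : Type} [Fintype 𝒵] [Nonempty 𝒵]
    (p : ((∀ d, 𝒴 d) × 𝒵) → ℝ) (hp : IsPMF p) (B : ℕ)
    (r : Fin D → ℕ) (F : Fin D → Type) [∀ d, Fintype (F d)] [∀ d, Nonempty (F d)]
    (ev : ∀ d, F d → (Fin B → 𝒴 d) → (Fin (r d) → Bool))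
    (huniv : ∀ d, TwoUniversal (F d) (ev d))
    (ε : ℝ) (hε : 0 < ε) :
    ∑ k : ∀ d, Fin (r d) → Bool, ∑ f : ∀ d, F d, ∑ zB : Fin B → 𝒵,
      |(∏ d, (Fintype.card (F d) : ℝ))⁻¹ *
          (∑ y : ∀ d, Fin B → 𝒴 d,
            if ∀ d, ev d (f d) (y d) = k d then ∏ i, p (fun d => y d i, zB i) else 0)
        - (Fintype.card (∀ d, Fin (r d) → Bool) : ℝ)⁻¹ *
            (Fintype.card (∀ d, F d) : ℝ)⁻¹ *
            ∏ i, ∑ yy : ∀ d, 𝒴 d, p (yy, zB i)|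
    ≤ 2 * ε + Real.sqrt (∑ S : Finset (Fin D),
        if S.Nonempty then
          (2 : ℝ) ^ ((∑ d ∈ S, (r d : ℝ))
            - (B : ℝ) * condEnt p (fun ω (d : {d // d ∈ S}) => ω.1 d.1) (fun ω => ω.2)
            + (B : ℝ) * (Real.logb 2 ((Fintype.card (∀ d : {d // d ∈ S}, 𝒴 d.1) : ℝ) + 3) *
                Real.sqrt ((2 / (B : ℝ)) * ((D : ℝ) + Real.logb 2 (1 / ε)))))
        else 0) := by

  set cS : Finset (Fin D) → ℝ := fun S => (2 : ℝ) ^ (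
            - ((B : ℝ) * condEnt p (fun ω (d : {d // d ∈ S}) => ω.1 d.1) (fun ω => ω.2))
            + (B : ℝ) * (Real.logb 2 ((Fintype.card (∀ d : {d // d ∈ S}, 𝒴 d.1) : ℝ) + 3) *
                Real.sqrt ((2 / (B : ℝ)) * ((D : ℝ) + Real.logb 2 (1 / ε))))) with hcS
  set Pw : (Fin B → 𝒵) → (∀ d, Fin B → 𝒴 d) → ℝ :=
    fun zB y => ∏ i, p (fun d => y d i, zB i) with hPw
  have hPw0 : ∀ z y, 0 ≤ Pw z y := fun z y => Finset.prod_nonneg fun i _ => hp.1 _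
  have hcS0 : ∀ S, 0 ≤ cS S := fun S => by positivity
  have hq : ∀ zB : Fin B → 𝒵, ∏ i, ∑ yy : ∀ d, 𝒴 d, p (yy, zB i) = ∑ y, Pw zB y := fun zB =>
    (sum_block (fun i yy => p (yy, zB i))).symm
  have hP1 : ∑ z, ∑ y, Pw z y = 1 := by
    have := sum_omega (B := B) (fun ω : Fin B → (∀ d, 𝒴 d) × 𝒵 => ∏ i, p (ω i))
    rw [hPw, this]
    have h2 := (Finset.sum_pow' (univ : Finset ((∀ d, 𝒴 d) × 𝒵)) p B)
    rw [Fintype.piFinset_univ, hp.2, one_pow] at h2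
    exact h2.symm
  have hexp : ∀ S : Finset (Fin D), (2 : ℝ) ^ ((∑ d ∈ S, (r d : ℝ))
            - (B : ℝ) * condEnt p (fun ω (d : {d // d ∈ S}) => ω.1 d.1) (fun ω => ω.2)
            + (B : ℝ) * (Real.logb 2 ((Fintype.card (∀ d : {d // d ∈ S}, 𝒴 d.1) : ℝ) + 3) *
                Real.sqrt ((2 / (B : ℝ)) * ((D : ℝ) + Real.logb 2 (1 / ε)))))
      = (∏ d ∈ S, (2 : ℝ) ^ r d) * cS S := by
    intro S
    rw [sub_add, sub_eq_add_neg, Real.rpow_add (by norm_num), hcS, Finset.prod_pow_eq_pow_sum,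
      ← Real.rpow_natCast]
    push_cast
    congr 2
    ring
  have hw : ∃ w : (Fin B → 𝒵) → (∀ d, Fin B → 𝒴 d) → ℝ, (∀ z y, 0 ≤ w z y) ∧
      (∀ z y, w z y ≤ Pw z y) ∧ (∑ z, ∑ y, (Pw z y - w z y) ≤ ε) ∧
      (∀ z, ∀ S : Finset (Fin D), S.Nonempty → ∀ y : ∀ d, Fin B → 𝒴 d,
        (∑ y' : ∀ d, Fin B → 𝒴 d, if ∀ d ∈ S, y d = y' d then w z y' else 0)
          ≤ (∑ y, Pw z y) * cS S) := by
    rcases le_or_gt 1 ε with h1 | h1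
    · refine ⟨fun _ _ => 0, fun _ _ => le_rfl, hPw0, ?_, ?_⟩
      · simpa [hP1] using h1
      · intro z S _ y
        simp only [ite_self, Finset.sum_const_zero]
        exact mul_nonneg (Finset.sum_nonneg fun y _ => hPw0 z y) (hcS0 S)
    · set T : ℝ := (D : ℝ) + Real.logb 2 (1 / ε) with hT
      have hT0 : 0 ≤ T := by
        have : 0 ≤ Real.logb 2 (1 / ε) :=
          Real.logb_nonneg (by norm_num) (by rw [le_div_iff₀ hε]; linarith)
        positivity
      have h2T : (2 : ℝ) ^ (-T) = ((2 : ℝ) ^ D)⁻¹ * ε := by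
        rw [hT, neg_add, Real.rpow_add (by norm_num), Real.rpow_neg (by norm_num),
          Real.rpow_natCast, one_div, Real.logb_inv, neg_neg,
          Real.rpow_logb (by norm_num) (by norm_num) hε]
      set bad : Finset (Fin D) → (Fin B → (∀ d, 𝒴 d) × 𝒵) → Prop := fun S ω =>
        cS S * ∏ i, prob p (fun ω => ω.2) (ω i).2 <
          ∏ i, prob p (fun ω => ((fun (d : {d // d ∈ S}) => ω.1 d.1), ω.2))
            ((fun (d : {d // d ∈ S}) => (ω i).1 d.1), (ω i).2) with hbad
      have htail : ∀ S, (∑ ω, if bad S ω then ∏ i, p (ω i) else 0) ≤ ((2 : ℝ) ^ D)⁻¹ * ε := by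
        intro S
        rw [← h2T]
        exact tail p hp (fun ω (d : {d // d ∈ S}) => ω.1 d.1) (fun ω => ω.2) B T hT0
      refine ⟨fun z y => if ∃ S, bad S (fun i => (fun d => y d i, z i)) then 0 else Pw z y,
        ?_, ?_, ?_, ?_⟩
      · intro z y
        dsimp only
        split_ifs
        · exact le_rfl
        · exact hPw0 z y
      · intro z y
        dsimp only
        split_ifs
        · exact hPw0 z y
        · exact le_rfl
      · have := sum_omega (B := B) (fun ω : Fin B → (∀ d, 𝒴 d) × 𝒵 =>
          (∏ i, p (ω i)) - if ∃ S, bad S ω then 0 else ∏ i, p (ω i))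
        refine (le_of_eq this).trans ?_
        calc _ ≤ ∑ ω, ∑ S : Finset (Fin D), if bad S ω then ∏ i, p (ω i) else 0 := by
              refine Finset.sum_le_sum fun ω _ => ?_
              have hnn : ∀ S ∈ (univ : Finset (Finset (Fin D))),
                  0 ≤ (if bad S ω then ∏ i, p (ω i) else 0) := fun S _ => by
                split_ifs
                · exact Finset.prod_nonneg fun i _ => hp.1 _
                · exact le_rfl
              split_ifs with h
              · obtain ⟨S, hS⟩ := h
                have := Finset.single_le_sum hnn (Finset.mem_univ S)
                rw [if_pos hS] at this
                linarith
              · rw [sub_self]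
                exact Finset.sum_nonneg hnn
          _ ≤ ∑ S : Finset (Fin D), ((2 : ℝ) ^ D)⁻¹ * ε := by
              rw [Finset.sum_comm]
              exact Finset.sum_le_sum fun S _ => htail S
          _ = ε := by
              simp
      · intro z S _ y
        dsimp only
        by_cases hb : bad S (fun i => (fun d => y d i, z i))
        · refine le_trans (le_of_eq ?_) (mul_nonneg (Finset.sum_nonneg fun y _ => hPw0 z y) (hcS0 S))
          refine Finset.sum_eq_zero fun y' _ => ?_
          split_ifs with h1 h2
          · rfl
          · exfalso
            refine h2 ⟨S, ?_⟩
            have : ∀ i, (fun (d : {d // d ∈ S}) => y' d.1 i) = (fun (d : {d // d ∈ S}) => y d.1 i) :=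
              fun i => funext fun d => by rw [h1 d.1 d.2]
            simp only [hbad, this]
            exact hb
          · rfl
        · simp only [hbad, not_lt] at hb
          have hqz : ∏ i, prob p (fun ω => ω.2) (z i) = ∑ y, Pw z y := by
            rw [← hq]
            refine Finset.prod_congr rfl fun i _ => ?_
            simp [prob, Fintype.sum_prod_type]
          rw [hqz, mul_comm] at hb
          refine le_trans ?_ hb
          have : ∀ i, prob p (fun ω => ((fun (d : {d // d ∈ S}) => ω.1 d.1), ω.2))
              ((fun (d : {d // d ∈ S}) => y d.1 i), z i) =
              ∑ yy : ∀ d, 𝒴 d, if ∀ d ∈ S, y d i = yy d then p (yy, z i) else 0 := by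
            intro i
            simp only [prob, Fintype.sum_prod_type]
            refine Finset.sum_congr rfl fun yy _ => ?_
            have hiff : (fun (d : {d // d ∈ S}) => yy d.1) = (fun (d : {d // d ∈ S}) => y d.1 i) ↔
                ∀ d ∈ S, y d i = yy d := by
              constructor
              · intro h d hd
                exact (congrFun h ⟨d, hd⟩).symm
              · intro h
                exact funext fun d => (h d.1 d.2).symm
            simp only [Prod.mk.injEq, hiff]
            rw [Finset.sum_eq_single (z i)]
            · by_cases h : ∀ d ∈ S, y d i = yy d
              · rw [if_pos ⟨h, rfl⟩, if_pos h]
              · rw [if_neg (fun x => h x.1), if_neg h]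
            · intro z' _ hz'
              exact if_neg (fun x => hz' x.2)
            · simp
          simp only [this]
          rw [← sum_block (fun i yy => if ∀ d ∈ S, y d i = yy d then p (yy, z i) else 0)]
          refine Finset.sum_le_sum fun y' _ => ?_
          have hnn : 0 ≤ ∏ i, (if ∀ d ∈ S, y d i = y' d i then p (fun d => y' d i, z i) else 0) :=
            Finset.prod_nonneg fun i _ => by
              split_ifs
              · exact hp.1 _
              · exact le_rfl
          split_ifs with h1 h2
          · exact hnn
          · refine le_of_eq (Finset.prod_congr rfl fun i _ => ?_)
            rw [if_pos]
            intro d hd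
            rw [h1 d hd]
          · exact hnn
  obtain ⟨w, hw0, hwP, hwε, hwS⟩ := hw
  simp only [hexp, hq]
  have hz := fun z => smooth_z r ev huniv (Pw z) (w z) cS hcS0 (hw0 z) (hwP z)
    (fun S hne y => by convert hwS z S hne y)
  rw [sum_rot]
  refine (Finset.sum_le_sum fun z _ => hz z).trans ?_
  rw [Finset.sum_add_distrib, ← Finset.mul_sum, ← Finset.sum_mul, hP1, one_mul]
  gcongr

end SecretSharing
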